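/- Let q ∈ (0,1/2), let a = (a_i) be a sequence of positive integers, and let (C,D) be the pair of generalised Cantor sets generated by (q,a). If the odd-indexed subsequence (a_{2i−1}) is unbounded, then dim_A C = −log 2/log q; and if the even-indexed subsequence (a_{2i}) is unbounded, then dim_A D = −log 2/log q. -/

import Mathlib

open Metric Set Filter
open scoped ENNReal NNReal

namespace Paper

noncomputable def coverNum {X : Type*} [MetricSpace X] (F : Set X) (r : ℝ) : ℝ≥0∞ :=
  ⨅ (s : Finset X) (_ : F ⊆ ⋃ x ∈ s, closedBall x r), (s.card : ℝ≥0∞)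

noncomputable def diamCoverNum {X : Type*} [MetricSpace X] (F : Set X) (r : ℝ) : ℝ≥0∞ :=
  ⨅ (U : Finset (Set X)) (_ : F ⊆ ⋃₀ ↑U)
    (_ : ∀ A ∈ U, EMetric.diam A ≤ ENNReal.ofReal r), (U.card : ℝ≥0∞)

noncomputable def lowerBoxDim {X : Type*} [MetricSpace X] (F : Set X) : ℝ :=
  Filter.liminf (fun r : ℝ => Real.log (coverNum F r).toReal / (-Real.log r))
    (nhdsWithin 0 (Set.Ioi 0))

noncomputable def upperBoxDim {X : Type*} [MetricSpace X] (F : Set X) : ℝ :=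
  Filter.limsup (fun r : ℝ => Real.log (coverNum F r).toReal / (-Real.log r))
    (nhdsWithin 0 (Set.Ioi 0))

def IsHomogeneous {X : Type*} [MetricSpace X] (F : Set X) (s : ℝ) : Prop :=
  ∀ δ₀ : ℝ, 0 < δ₀ → ∃ C : ℝ, 0 < C ∧
    ∀ x ∈ F, ∀ δ ρ : ℝ, 0 < ρ → ρ < δ → δ ≤ δ₀ →
      coverNum (closedBall x δ ∩ F) ρ ≤ ENNReal.ofReal (C * (δ / ρ) ^ s)

noncomputable def assouadDim {X : Type*} [MetricSpace X] (F : Set X) : EReal :=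
  sInf ((fun s : ℝ => (s : EReal)) '' {s : ℝ | 0 ≤ s ∧ IsHomogeneous F s})

def EquiHomogeneous {X : Type*} [MetricSpace X] (F : Set X) : Prop :=
  ∀ δ₀ : ℝ, 0 < δ₀ → ∃ M : ℝ≥0, 1 ≤ M ∧ ∃ c₁ c₂ : ℝ, 0 < c₁ ∧ 0 < c₂ ∧
    ∀ δ ρ : ℝ, 0 < ρ → ρ < δ → δ ≤ δ₀ →
      (⨆ x ∈ F, coverNum (closedBall x δ ∩ F) ρ) ≤
        (M : ℝ≥0∞) * ⨅ x ∈ F, coverNum (closedBall x (c₁ * δ) ∩ F) (c₂ * ρ)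

noncomputable def cantorLen (lam : ℕ → ℝ) (n : ℕ) : ℝ := ∏ i ∈ Finset.range n, lam i

noncomputable def cantorPre (lam : ℕ → ℝ) (n : ℕ) : Set ℝ :=
  ⋃ ε : ℕ → Bool,
    Set.Icc (∑ i ∈ Finset.range n, if ε i then cantorLen lam i - cantorLen lam (i + 1) else 0)
      ((∑ i ∈ Finset.range n, if ε i then cantorLen lam i - cantorLen lam (i + 1) else 0) +
        cantorLen lam n)

noncomputable def cantorSet (lam : ℕ → ℝ) : Set ℝ := ⋂ n : ℕ, cantorPre lam n

open Classical in
noncomputable def lamSeq (q : ℝ) (a : ℕ → ℕ) (i : ℕ) : ℝ :=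
  if h : ∃ k : ℕ, i + 1 = ∑ j ∈ Finset.range (k + 1), a (2 * j) then
    q ^ (a (2 * h.choose + 1) + 1)
  else q

open Classical in
noncomputable def muSeq (q : ℝ) (a : ℕ → ℕ) (i : ℕ) : ℝ :=
  if h : ∃ k : ℕ, i + 1 = a 0 + ∑ j ∈ Finset.range (k + 1), a (2 * j + 1) then
    q ^ (a (2 * h.choose + 2) + 1)
  else q

noncomputable def prodSetL2 (C D : Set ℝ) : Set (WithLp 2 (ℝ × ℝ)) :=
  (WithLp.equiv 2 (ℝ × ℝ)).symm '' (C ×ˢ D)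

/-- The left endpoint of the level-`n` basic interval of the Cantor construction with code `ε`. -/
noncomputable def cantorLeft (lam : ℕ → ℝ) (ε : ℕ → Bool) (n : ℕ) : ℝ :=
  ∑ i ∈ Finset.range n, if ε i then cantorLen lam i - cantorLen lam (i + 1) else 0

section Cantor

variable {lam : ℕ → ℝ} {q : ℝ}

lemma mem_cantorSet_iff {y : ℝ} :
    y ∈ cantorSet lam ↔ ∀ n, ∃ ε : ℕ → Bool,
      y ∈ Icc (cantorLeft lam ε n) (cantorLeft lam ε n + cantorLen lam n) := by
  simp only [cantorSet, cantorPre, mem_iInter, mem_iUnion, cantorLeft]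

lemma cantorLen_succ (n : ℕ) : cantorLen lam (n + 1) = cantorLen lam n * lam n :=
  Finset.prod_range_succ _ _

lemma cantorLeft_succ (ε : ℕ → Bool) (n : ℕ) :
    cantorLeft lam ε (n + 1) =
      cantorLeft lam ε n + if ε n then cantorLen lam n - cantorLen lam (n + 1) else 0 :=
  Finset.sum_range_succ _ _

lemma cantorLeft_congr {ε ε' : ℕ → Bool} {n : ℕ} (h : ∀ i < n, ε i = ε' i) :
    cantorLeft lam ε n = cantorLeft lam ε' n :=
  Finset.sum_congr rfl fun i hi => by rw [h i (Finset.mem_range.1 hi)]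

lemma cantorLen_pos (h0 : ∀ i, 0 < lam i) (n : ℕ) : 0 < cantorLen lam n :=
  Finset.prod_pos fun i _ => h0 i

lemma cantorLen_succ_le (h0 : ∀ i, 0 < lam i) (hle : ∀ i, lam i ≤ q) (n : ℕ) :
    cantorLen lam (n + 1) ≤ q * cantorLen lam n := by
  rw [cantorLen_succ, mul_comm]
  exact mul_le_mul_of_nonneg_right (hle n) (cantorLen_pos h0 n).le

lemma cantorLen_antitone (h0 : ∀ i, 0 < lam i) (h1 : ∀ i, lam i ≤ 1) :
    Antitone (cantorLen lam) :=
  antitone_nat_of_succ_le fun n => by simpa using cantorLen_succ_le h0 h1 n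

lemma cantorLen_add_le (hq : 0 < q) (h0 : ∀ i, 0 < lam i) (hle : ∀ i, lam i ≤ q) (k j : ℕ) :
    cantorLen lam (k + j) ≤ q ^ j * cantorLen lam k := by
  induction j with
  | zero => simp
  | succ j ih =>
    calc cantorLen lam (k + j + 1) ≤ q * cantorLen lam (k + j) := cantorLen_succ_le h0 hle _
      _ ≤ q * (q ^ j * cantorLen lam k) := by gcongr
      _ = q ^ (j + 1) * cantorLen lam k := by ring

lemma cantorLen_add_eq {p N : ℕ} (h : ∀ i < N, lam (p + i) = q) {j : ℕ} (hj : j ≤ N) :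
    cantorLen lam (p + j) = q ^ j * cantorLen lam p := by
  induction j with
  | zero => simp
  | succ j ih => rw [← add_assoc, cantorLen_succ, ih (by omega), h j (by omega)]; ring

lemma cantorInterval_antitone (h0 : ∀ i, 0 < lam i) (h1 : ∀ i, lam i ≤ 1) (ε : ℕ → Bool) :
    Antitone fun n => Icc (cantorLeft lam ε n) (cantorLeft lam ε n + cantorLen lam n) := by
  refine antitone_nat_of_succ_le fun n => ?_
  have h := cantorLen_antitone h0 h1 n.le_succ
  rw [Nat.succ_eq_add_one] at h
  apply Icc_subset_Icc <;> rw [cantorLeft_succ] <;> split_ifs <;> linarith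

/-- Points with different codes up to level `n` are separated by a multiple of the length at
level `n - 1`. -/
lemma cantor_separation (hq : 0 < q) (hq2 : q < 1 / 2) (h0 : ∀ i, 0 < lam i)
    (hle : ∀ i, lam i ≤ q) {ε ε' : ℕ → Bool} {n k : ℕ} {x y : ℝ}
    (hx : x ∈ Icc (cantorLeft lam ε n) (cantorLeft lam ε n + cantorLen lam n))
    (hy : y ∈ Icc (cantorLeft lam ε' n) (cantorLeft lam ε' n + cantorLen lam n))
    (hkn : k < n) (hne : ε k ≠ ε' k) :
    (1 - 2 * q) * cantorLen lam k ≤ |x - y| := by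
  classical
  have h1 : ∀ i, lam i ≤ 1 := fun i => (hle i).trans (by linarith)
  have hex : ∃ i, ε i ≠ ε' i := ⟨k, hne⟩
  set i := Nat.find hex
  have hik : i ≤ k := Nat.find_min' hex hne
  have hagree : ∀ j < i, ε j = ε' j := fun j hj => not_not.1 (Nat.find_min hex hj)
  have hdiff : ε i ≠ ε' i := Nat.find_spec hex
  have hx' := cantorInterval_antitone h0 h1 ε (show i + 1 ≤ n by omega) hx
  have hy' := cantorInterval_antitone h0 h1 ε' (show i + 1 ≤ n by omega) hy
  simp only [cantorLeft_succ, cantorLeft_congr hagree, mem_Icc] at hx' hy'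
  have hs := cantorLen_succ_le h0 hle i
  have hmono : (1 - 2 * q) * cantorLen lam k ≤ (1 - 2 * q) * cantorLen lam i :=
    mul_le_mul_of_nonneg_left (cantorLen_antitone h0 h1 hik) (by linarith)
  rcases Bool.eq_false_or_eq_true (ε i) with h | h <;>
    rcases Bool.eq_false_or_eq_true (ε' i) with h' | h' <;>
    simp only [h, h', ne_eq, not_true_eq_false, if_true, Bool.false_eq_true, if_false]
      at hdiff hx' hy'
  · exact le_trans (by linarith) (le_abs_self _)
  · exact le_trans (by linarith) (neg_le_abs _)

/-- The left endpoint of a basic interval belongs to the Cantor set. -/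
lemma cantorLeft_mem_cantorSet (h0 : ∀ i, 0 < lam i) (h1 : ∀ i, lam i ≤ 1) {ε : ℕ → Bool} {n : ℕ}
    (hε : ∀ i, n ≤ i → ε i = false) : cantorLeft lam ε n ∈ cantorSet lam := by
  rw [mem_cantorSet_iff]
  have hconst : ∀ j, cantorLeft lam ε (n + j) = cantorLeft lam ε n := by
    intro j
    induction j with
    | zero => rfl
    | succ j ih => rw [← add_assoc, cantorLeft_succ, ih, hε _ (by omega)]; simp
  refine fun m => ⟨ε, cantorInterval_antitone h0 h1 ε (show m ≤ n + m by omega) ?_⟩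
  simp only [hconst, mem_Icc, le_refl, true_and, le_add_iff_nonneg_right]
  exact (cantorLen_pos h0 _).le

lemma coverNum_le_card {X : Type*} [MetricSpace X] {F : Set X} {r : ℝ} (s : Finset X)
    (h : F ⊆ ⋃ x ∈ s, closedBall x r) : coverNum F r ≤ s.card :=
  iInf₂_le s h

/-- A finite family of points of `F` that are pairwise more than `2r` apart bounds the covering
number from below. -/
lemma card_le_coverNum {X ι : Type*} [MetricSpace X] {F : Set X} {r : ℝ} (t : Finset ι)
    (f : ι → X) (hf : ∀ i ∈ t, f i ∈ F)
    (hsep : ∀ i ∈ t, ∀ j ∈ t, i ≠ j → 2 * r < dist (f i) (f j)) :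
    (t.card : ℝ≥0∞) ≤ coverNum F r := by
  refine le_iInf₂ fun s hs => ?_
  have hc : ∀ i ∈ t, ∃ x ∈ s, dist (f i) x ≤ r := fun i hi => by
    simpa [mem_closedBall] using hs (hf i hi)
  have : t.card ≤ s.card := by
    rcases t.eq_empty_or_nonempty with rfl | ⟨i₀, _⟩
    · simp
    have : Nonempty X := ⟨f i₀⟩
    choose! g hg hgr using hc
    refine Finset.card_le_card_of_injOn g hg fun i hi j hj hij => ?_
    by_contra hne
    have h₁ := hsep i hi j hj hne
    have h₂ := dist_triangle_right (f i) (f j) (g i)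
    have h₃ := hgr i hi
    have h₄ := hgr j hj
    rw [← hij] at h₄
    linarith
  exact_mod_cast this

lemma exists_cantorLen_le (hq : 0 < q) (hq1 : q < 1) (h0 : ∀ i, 0 < lam i)
    (hle : ∀ i, lam i ≤ q) {r : ℝ} (hr : 0 < r) : ∃ n, cantorLen lam n ≤ r := by
  obtain ⟨n, hn⟩ := exists_pow_lt_of_lt_one hr hq1
  refine ⟨n, le_trans ?_ hn.le⟩
  simpa [cantorLen] using cantorLen_add_le hq h0 hle 0 n

/-- The points of the Cantor set that share the first `k` digits with a given code are covered by
`2 ^ (m - k)` balls whose radius is the length at level `m`. -/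
lemma exists_cover_cylinder (ε : ℕ → Bool) (k m : ℕ) {ρ : ℝ} (hρ : cantorLen lam m ≤ ρ) :
    ∃ s : Finset ℝ, s.card ≤ 2 ^ (m - k) ∧ ∀ (y : ℝ) (ε' : ℕ → Bool), (∀ i < k, ε' i = ε i) →
      y ∈ Icc (cantorLeft lam ε' m) (cantorLeft lam ε' m + cantorLen lam m) →
      ∃ x ∈ s, y ∈ closedBall x ρ := by
  classical
  let code : Finset ℕ → ℕ → Bool := fun T i => if i < k then ε i else decide (i ∈ T)
  refine ⟨(Finset.Ico k m).powerset.image fun T => cantorLeft lam (code T) m, ?_, ?_⟩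
  · refine Finset.card_image_le.trans ?_
    simp
  · intro y ε' hε' hy
    refine ⟨cantorLeft lam ε' m, Finset.mem_image.2
      ⟨(Finset.Ico k m).filter fun i => ε' i = true, by simp, ?_⟩, ?_⟩
    · refine cantorLeft_congr fun i hi => ?_
      by_cases hik : i < k
      · simp [code, hik, hε' i hik]
      · simp [code, hik, hi, not_lt.1 hik]
    · rw [mem_closedBall, Real.dist_eq, abs_le]
      exact ⟨by linarith [hy.1, hy.2], by linarith [hy.1, hy.2]⟩

theorem isHomogeneous_cantorSet (hq : 0 < q) (hq2 : q < 1 / 2) (h0 : ∀ i, 0 < lam i)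
    (hle : ∀ i, lam i ≤ q) {s : ℝ} (hs : 0 ≤ s) (hqs : q ^ s = 1 / 2) :
    IsHomogeneous (cantorSet lam) s := by
  classical
  have h1 : ∀ i, lam i ≤ 1 := fun i => (hle i).trans (by linarith)
  have hg : 0 < 1 - 2 * q := by linarith
  intro δ₀ _
  refine ⟨2 * ((1 - 2 * q) ^ s)⁻¹, by positivity, fun x hx δ ρ hρ hρδ _ => ?_⟩
  have hδ : 0 < δ := hρ.trans hρδ
  have hk : ∃ n, (1 - 2 * q) * cantorLen lam n ≤ δ := by
    obtain ⟨n, hn⟩ := exists_cantorLen_le hq (by linarith) h0 hle (div_pos hδ hg)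
    exact ⟨n, by rwa [le_div_iff₀' hg] at hn⟩
  have hm := exists_cantorLen_le hq (by linarith) h0 hle hρ
  set k := Nat.find hk
  set m := Nat.find hm
  have hkδ : (1 - 2 * q) * cantorLen lam k ≤ δ := Nat.find_spec hk
  have hmρ : cantorLen lam m ≤ ρ := Nat.find_spec hm
  obtain ⟨ε, hε⟩ := mem_cantorSet_iff.1 hx (max k m)
  obtain ⟨S, hScard, hS⟩ := exists_cover_cylinder ε k m hmρ
  have hcover : closedBall x δ ∩ cantorSet lam ⊆ ⋃ z ∈ S, closedBall z ρ := by
    rintro y ⟨hyx, hy⟩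
    obtain ⟨ε', hε'⟩ := mem_cantorSet_iff.1 hy (max k m)
    have hagree : ∀ i < k, ε' i = ε i := by
      intro i hi
      by_contra hne
      have := cantor_separation hq hq2 h0 hle hε' hε (lt_max_of_lt_left hi) hne
      rw [mem_closedBall, Real.dist_eq] at hyx
      exact Nat.find_min hk hi (this.trans hyx)
    simpa using hS y ε' hagree (cantorInterval_antitone h0 h1 ε' (le_max_right k m) hε')
  refine (coverNum_le_card S hcover).trans ?_
  rw [← ENNReal.ofReal_natCast]
  refine ENNReal.ofReal_le_ofReal ((Nat.cast_le.2 hScard).trans ?_)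
  push_cast
  have hpow : ∀ j : ℕ, (q ^ j) ^ s = ((2 : ℝ) ^ j)⁻¹ := fun j => by
    rw [← Real.rpow_natCast_mul hq.le, mul_comm, Real.rpow_mul_natCast hq.le, hqs]; simp
  have hratio : (1 : ℝ) ≤ (δ / ρ) ^ s := Real.one_le_rpow ((one_le_div hρ).2 hρδ.le) hs
  rcases Nat.lt_or_ge k m with hkm | hkm
  · obtain ⟨j, hj⟩ := Nat.exists_eq_add_of_lt hkm
    have hlt : ρ < cantorLen lam (k + j) := not_le.1 (Nat.find_min hm (show k + j < m by omega))
    have hle' := cantorLen_add_le hq h0 hle k j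
    have hbase : (1 - 2 * q) ≤ q ^ j * (δ / ρ) := by
      rw [← mul_div_assoc, le_div_iff₀ hρ]
      calc (1 - 2 * q) * ρ ≤ (1 - 2 * q) * (q ^ j * cantorLen lam k) := by
            gcongr; exact hlt.le.trans hle'
        _ = q ^ j * ((1 - 2 * q) * cantorLen lam k) := by ring
        _ ≤ q ^ j * δ := by gcongr
    have := Real.rpow_le_rpow hg.le hbase hs
    rw [Real.mul_rpow (by positivity) (by positivity), hpow, inv_mul_eq_div,
      le_div_iff₀ (by positivity)] at this
    rw [show m - k = j + 1 by omega, pow_succ, mul_comm, mul_assoc]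
    gcongr
    rwa [inv_mul_eq_div, le_div_iff₀ (by positivity), mul_comm]
  · rw [Nat.sub_eq_zero_of_le hkm, pow_zero]
    have hinv : (1 : ℝ) ≤ ((1 - 2 * q) ^ s)⁻¹ :=
      (one_le_inv₀ (by positivity)).2 (Real.rpow_le_one hg.le (by linarith) hs)
    nlinarith [mul_le_mul hinv hratio zero_le_one (by linarith)]

theorem le_of_isHomogeneous_cantorSet (hq : 0 < q) (hq2 : q < 1 / 2) (h0 : ∀ i, 0 < lam i)
    (hle : ∀ i, lam i ≤ q) (hrun : ∀ N : ℕ, ∃ p, ∀ i < N, lam (p + i) = q) {t : ℝ}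
    (hom : IsHomogeneous (cantorSet lam) t) : 2 * q ^ t ≤ 1 := by
  classical
  have h1 : ∀ i, lam i ≤ 1 := fun i => (hle i).trans (by linarith)
  have hg : 0 < 1 - 2 * q := by linarith
  obtain ⟨C, hC, hcov⟩ := hom 1 one_pos
  set K : ℝ := C * (3 / (1 - 2 * q)) ^ t
  have hbound : ∀ N : ℕ, (2 * q ^ t) ^ N * 2 ≤ K := by
    intro N
    obtain ⟨p, hp⟩ := hrun N
    have hlen : cantorLen lam (p + N) = q ^ N * cantorLen lam p := cantorLen_add_eq hp le_rfl
    have hLp := cantorLen_pos h0 p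
    set ρ := (1 - 2 * q) * cantorLen lam (p + N) / 3 with hρdef
    have hL := cantorLen_pos h0 (p + N)
    have hρ : 0 < ρ := by positivity
    have hLle : cantorLen lam (p + N) ≤ cantorLen lam p :=
      cantorLen_antitone h0 h1 (by omega)
    have hρδ : ρ < cantorLen lam p := by
      have : (1 - 2 * q) * cantorLen lam (p + N) < 1 * cantorLen lam (p + N) :=
        mul_lt_mul_of_pos_right (by linarith) hL
      linarith
    have hLp1 : cantorLen lam p ≤ 1 := by
      simpa [cantorLen] using cantorLen_antitone h0 h1 (Nat.zero_le p)
    have hzero : (0 : ℝ) ∈ cantorSet lam := by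
      simpa [cantorLeft] using
        cantorLeft_mem_cantorSet (lam := lam) (ε := fun _ => false) (n := 0) h0 h1 (by simp)
    let code : Finset ℕ → ℕ → Bool := fun T i => decide (i ∈ T)
    let pt : Finset ℕ → ℝ := fun T => cantorLeft lam (code T) (p + N + 1)
    have hcard := card_le_coverNum (F := closedBall 0 (cantorLen lam p) ∩ cantorSet lam) (r := ρ)
      (Finset.Ico p (p + N + 1)).powerset pt ?_ ?_
    · have hfin := hcard.trans (hcov 0 hzero _ ρ hρ hρδ hLp1)
      rw [← ENNReal.ofReal_natCast, ENNReal.ofReal_le_ofReal_iff (by positivity)] at hfin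
      have hdiv : cantorLen lam p / ρ = (3 / (1 - 2 * q)) * (q ^ N)⁻¹ := by
        rw [hρdef, hlen]; field_simp
      rw [hdiv, Real.mul_rpow (by positivity) (by positivity), Real.inv_rpow (by positivity),
        ← Real.rpow_natCast_mul hq.le, mul_comm (N : ℝ), Real.rpow_mul_natCast hq.le,
        ← mul_assoc, ← div_eq_mul_inv, le_div_iff₀ (by positivity), Finset.card_powerset,
        Nat.card_Ico, show p + N + 1 - p = N + 1 by omega] at hfin
      push_cast at hfin
      calc (2 * q ^ t) ^ N * 2 = 2 ^ (N + 1) * (q ^ t) ^ N := by ring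
        _ ≤ K := hfin
    · intro T hT
      have hT' : ∀ i ∈ T, p ≤ i ∧ i < p + N + 1 := fun i hi =>
        Finset.mem_Ico.1 (Finset.mem_powerset.1 hT hi)
      have hself : pt T ∈ Icc (cantorLeft lam (code T) (p + N + 1))
          (cantorLeft lam (code T) (p + N + 1) + cantorLen lam (p + N + 1)) :=
        ⟨le_rfl, le_add_of_nonneg_right (cantorLen_pos h0 _).le⟩
      have hmem := cantorInterval_antitone h0 h1 (code T) (show p ≤ p + N + 1 by omega) hself
      have hleft : cantorLeft lam (code T) p = 0 :=
        Finset.sum_eq_zero fun i hi => by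
          have : i ∉ T := fun h => by
            have := (hT' i h).1
            have := Finset.mem_range.1 hi
            omega
          simp [code, this]
      simp only [hleft, zero_add, mem_Icc] at hmem
      refine ⟨?_, cantorLeft_mem_cantorSet h0 h1 fun i hi => ?_⟩
      · rw [mem_closedBall, Real.dist_eq, sub_zero, abs_of_nonneg hmem.1]
        exact hmem.2
      · have : i ∉ T := fun h => by
          have := (hT' i h).2
          omega
        simp [code, this]
    · intro T hT T' hT' hne
      obtain ⟨i, hi⟩ : ∃ i, ¬(i ∈ T ↔ i ∈ T') := by
        by_contra! h
        exact hne (Finset.ext h)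
      have hiN : i < p + N + 1 := by
        by_cases h : i ∈ T
        · exact (Finset.mem_Ico.1 (Finset.mem_powerset.1 hT h)).2
        · have h' : i ∈ T' := by tauto
          exact (Finset.mem_Ico.1 (Finset.mem_powerset.1 hT' h')).2
      have hsep := cantor_separation hq hq2 h0 hle (ε := code T) (ε' := code T') (n := p + N + 1)
        (x := pt T) (y := pt T') (k := i)
        ⟨le_rfl, le_add_of_nonneg_right (cantorLen_pos h0 _).le⟩
        ⟨le_rfl, le_add_of_nonneg_right (cantorLen_pos h0 _).le⟩ hiN
        (by simpa [code] using hi)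
      have hmono : (1 - 2 * q) * cantorLen lam (p + N) ≤ (1 - 2 * q) * cantorLen lam i :=
        mul_le_mul_of_nonneg_left (cantorLen_antitone h0 h1 (by omega)) hg.le
      rw [Real.dist_eq]
      linarith
  by_contra! hgt
  obtain ⟨N, hN⟩ := pow_unbounded_of_one_lt K hgt
  have : 0 < (2 * q ^ t) ^ N := by positivity
  linarith [hbound N]

/-- The Assouad dimension of a Cantor set with contraction ratios at most `q` that contain
arbitrarily long runs of `q`. -/
theorem assouadDim_cantorSet (hq : 0 < q) (hq2 : q < 1 / 2) (h0 : ∀ i, 0 < lam i)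
    (hle : ∀ i, lam i ≤ q) (hrun : ∀ N : ℕ, ∃ p, ∀ i < N, lam (p + i) = q) :
    assouadDim (cantorSet lam) = ((-(Real.log 2 / Real.log q) : ℝ) : EReal) := by
  have hlogq : Real.log q < 0 := Real.log_neg hq (by linarith)
  have hlog2 : 0 < Real.log 2 := Real.log_pos one_lt_two
  have hs : 0 ≤ -(Real.log 2 / Real.log q) :=
    neg_nonneg.2 (div_nonpos_of_nonneg_of_nonpos hlog2.le hlogq.le)
  have hqs : q ^ (-(Real.log 2 / Real.log q)) = 1 / 2 := by
    rw [Real.rpow_def_of_pos hq, mul_neg, mul_div_cancel₀ _ hlogq.ne, Real.exp_neg,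
      Real.exp_log two_pos, one_div]
  refine le_antisymm
    (sInf_le ⟨_, ⟨hs, isHomogeneous_cantorSet hq hq2 h0 hle hs hqs⟩, rfl⟩) (le_sInf ?_)
  rintro _ ⟨t, ⟨_, ht⟩, rfl⟩
  have h2 := le_of_isHomogeneous_cantorSet hq hq2 h0 hle hrun ht
  refine EReal.coe_le_coe_iff.2 ((Real.rpow_le_rpow_left_iff_of_base_lt_one hq
    (by linarith)).1 ?_)
  rw [hqs]
  linarith

end Cantor

/-- Between consecutive partial sums `c + b 0 + ⋯ + b (i - 1)` and `c + b 0 + ⋯ + b i` there is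
no further partial sum. -/
lemma exists_long_gap {b : ℕ → ℕ} (c : ℕ) (hb : ∀ N : ℕ, ∃ i, N < b i) (N : ℕ) :
    ∃ p, ∀ i < N, ¬∃ k : ℕ, p + i + 1 = c + ∑ j ∈ Finset.range (k + 1), b j := by
  obtain ⟨n, hn⟩ := hb N
  refine ⟨c + ∑ j ∈ Finset.range n, b j, ?_⟩
  rintro i hi ⟨k, hk⟩
  have hmono : Monotone fun m => ∑ j ∈ Finset.range m, b j := fun _ _ h =>
    Finset.sum_le_sum_of_subset (Finset.range_mono h)
  rcases Nat.lt_or_ge k n with h | h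
  · have := hmono (show k + 1 ≤ n by omega)
    simp only at this
    omega
  · have := hmono (show n + 1 ≤ k + 1 by omega)
    simp only [Finset.sum_range_succ _ n] at this
    omega

lemma pow_succ_le_self_of_lt_half {q : ℝ} (hq : q ∈ Ioo (0 : ℝ) (1 / 2)) (n : ℕ) :
    q ^ (n + 1) ≤ q :=
  pow_le_of_le_one hq.1.le (by linarith [hq.2]) n.succ_ne_zero

theorem statement16 (q : ℝ) (hq : q ∈ Set.Ioo (0 : ℝ) (1 / 2))
    (a : ℕ → ℕ) (ha : ∀ i, 0 < a i) :
    ((∀ N : ℕ, ∃ i : ℕ, N < a (2 * i)) →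
        assouadDim (cantorSet (lamSeq q a)) = ((-(Real.log 2 / Real.log q) : ℝ) : EReal)) ∧
      ((∀ N : ℕ, ∃ i : ℕ, N < a (2 * i + 1)) →
        assouadDim (cantorSet (muSeq q a)) = ((-(Real.log 2 / Real.log q) : ℝ) : EReal)) := by
  refine ⟨fun h => ?_, fun h => ?_⟩
  · refine assouadDim_cantorSet hq.1 hq.2 (fun i => ?_) (fun i => ?_) fun N => ?_
    · unfold lamSeq
      split_ifs
      exacts [pow_pos hq.1 _, hq.1]
    · unfold lamSeq
      split_ifs
      exacts [pow_succ_le_self_of_lt_half hq _, le_rfl]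
    · obtain ⟨p, hp⟩ := exists_long_gap (b := fun j => a (2 * j)) 0 h N
      exact ⟨p, fun i hi => dif_neg (by simpa only [zero_add] using hp i hi)⟩
  · refine assouadDim_cantorSet hq.1 hq.2 (fun i => ?_) (fun i => ?_) fun N => ?_
    · unfold muSeq
      split_ifs
      exacts [pow_pos hq.1 _, hq.1]
    · unfold muSeq
      split_ifs
      exacts [pow_succ_le_self_of_lt_half hq _, le_rfl]
    · obtain ⟨p, hp⟩ := exists_long_gap (b := fun j => a (2 * j + 1)) (a 0) h N
      exact ⟨p, fun i hi => dif_neg (hp i hi)⟩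

end Paper
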